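/- For m = 4, the homotopy relation on transversal Volterra operators has exactly 112 equivalence classes: there exist 112 transversal real skew-symmetric 4×4 matrices with entries of absolute value ≤ 1 whose associated Volterra operators are pairwise non-homotopic, such that every transversal real skew-symmetric 4×4 matrix with entries of absolute value ≤ 1 has its Volterra operator homotopic to one of these 112. -/

import Mathlib

open Matrix

/-- A matrix defining a Volterra quadratic stochastic operator:
skew-symmetric with entries of absolute value at most 1. -/
def IsQSOMatrix {n : Type*} [Fintype n] (A : Matrix n n ℝ) : Prop :=
  Aᵀ = -A ∧ ∀ i j, |A i j| ≤ 1

/-- The Volterra quadratic stochastic operator associated to a matrix `A`: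
`(V_A x)_k = x_k (1 + ∑ i, a_{k i} x_i)`. -/
noncomputable def volterra {n : Type*} [Fintype n] (A : Matrix n n ℝ) (x : n → ℝ) : n → ℝ :=
  fun k => x k * (1 + ∑ i, A k i * x i)

/-- The set of fixed points of `V_A` in the standard simplex. -/
def FixSet {n : Type*} [Fintype n] (A : Matrix n n ℝ) : Set (n → ℝ) :=
  {x ∈ stdSimplex ℝ n | volterra A x = x}

/-- A skew-symmetric matrix is transversal if every principal submatrix on an
evenly-sized index set has nonzero determinant. -/
def IsTransversal {n : Type*} [Fintype n] [DecidableEq n] (A : Matrix n n ℝ) : Prop :=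
  ∀ s : Finset n, Even s.card →
    (A.submatrix (fun i : s => (i : n)) (fun i : s => (i : n))).det ≠ 0

/-- Two (transversal) Volterra operators are homotopic if they are joined by a
continuous family of transversal Volterra matrices along which the number of
fixed points is constant. -/
def QSOHomotopic {n : Type*} [Fintype n] [DecidableEq n] (A₀ A₁ : Matrix n n ℝ) : Prop :=
  ∃ A : ℝ → Matrix n n ℝ,
    ContinuousOn A (Set.Icc 0 1) ∧
    A 0 = A₀ ∧ A 1 = A₁ ∧
    (∀ t ∈ Set.Icc (0:ℝ) 1, IsQSOMatrix (A t) ∧ IsTransversal (A t)) ∧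
    (∀ t ∈ Set.Icc (0:ℝ) 1, (FixSet (A t)).ncard = (FixSet A₀).ncard) ∧
    (FixSet A₀).ncard = (FixSet A₁).ncard

section FixedPoints

variable {n : Type*} [Fintype n]

theorem mem_fixSet_iff {A : Matrix n n ℝ} {x : n → ℝ} :
    x ∈ FixSet A ↔ (∀ k, 0 ≤ x k) ∧ ∑ k, x k = 1 ∧ ∀ k, x k ≠ 0 → ∑ i, A k i * x i = 0 := by
  have key : volterra A x = x ↔ ∀ k, x k ≠ 0 → ∑ i, A k i * x i = 0 := by
    rw [funext_iff]
    refine forall_congr' fun k => ?_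
    simp only [volterra, mul_add, mul_one, add_eq_left, mul_eq_zero]
    tauto
  simp only [FixSet, stdSimplex, Set.mem_ofPred_eq, key, and_assoc]

/-- The support of a vector, as a finite set. -/
noncomputable def suppFinset (x : n → ℝ) : Finset n := {k | x k ≠ 0}

theorem mem_suppFinset {x : n → ℝ} {k : n} : k ∈ suppFinset x ↔ x k ≠ 0 := by
  simp [suppFinset]

variable [DecidableEq n]

theorem IsTransversal.eq_zero_of_kernel {A : Matrix n n ℝ} (hA : IsTransversal A) {s : Finset n}
    (hs : Even s.card) {z : n → ℝ} (hz : ∀ k ∉ s, z k = 0)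
    (hk : ∀ k ∈ s, ∑ i, A k i * z i = 0) : z = 0 := by
  have h0 : (fun i : s => z i) = 0 := by
    refine Matrix.eq_zero_of_mulVec_eq_zero (hA s hs) (funext fun k => ?_)
    have hsum : ∑ i ∈ s, A k i * z i = ∑ i, A k i * z i :=
      Finset.sum_subset (Finset.subset_univ s) fun i _ hi => by rw [hz i hi, mul_zero]
    simp only [Matrix.mulVec, dotProduct, Matrix.submatrix_apply, Pi.zero_apply]
    rw [Finset.sum_coe_sort s (fun i => A k i * z i), hsum, hk k k.2]
  funext k
  by_cases hks : k ∈ s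
  · exact congrFun h0 ⟨k, hks⟩
  · exact hz k hks

theorem odd_card_suppFinset {A : Matrix n n ℝ} (hA : IsTransversal A) {x : n → ℝ}
    (hx : x ∈ FixSet A) : Odd (suppFinset x).card := by
  obtain ⟨-, h1, h2⟩ := mem_fixSet_iff.1 hx
  by_contra hodd
  have hx0 := hA.eq_zero_of_kernel (Nat.not_odd_iff_even.1 hodd) (z := x)
    (fun k hk => by simpa [mem_suppFinset] using hk) fun k hk => h2 k (mem_suppFinset.1 hk)
  simp [hx0] at h1

/-- A fixed point of a transversal operator is determined by its support. -/
theorem injOn_suppFinset {A : Matrix n n ℝ} (hA : IsTransversal A) :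
    Set.InjOn suppFinset (FixSet A) := by
  intro x hx y hy hxy
  have hodd := odd_card_suppFinset hA hx
  obtain ⟨-, hx1, hx2⟩ := mem_fixSet_iff.1 hx
  obtain ⟨-, hy1, hy2⟩ := mem_fixSet_iff.1 hy
  have hsupp : ∀ k, x k ≠ 0 ↔ y k ≠ 0 := fun k => by
    rw [← mem_suppFinset, hxy, mem_suppFinset]
  obtain ⟨i, hi⟩ := Finset.card_pos.1 hodd.pos
  have hyi : y i ≠ 0 := (hsupp i).1 (mem_suppFinset.1 hi)
  have heven : Even ((suppFinset x).erase i).card := by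
    rw [Finset.card_erase_of_mem hi]
    exact Nat.Odd.sub_odd hodd odd_one
  have hz := hA.eq_zero_of_kernel heven (z := fun k => x k - x i / y i * y k)
    (fun k hk => by
      by_cases hki : k = i
      · subst hki
        field_simp
        ring
      · have hxk : x k = 0 := by simpa [hki, mem_suppFinset] using hk
        have hyk : y k = 0 := by
          by_contra h
          exact (hsupp k).2 h hxk
        simp [hxk, hyk])
    (fun k hk => by
      have hxk := mem_suppFinset.1 (Finset.mem_of_mem_erase hk)
      have hsplit : ∑ j, A k j * (x j - x i / y i * y j)
          = ∑ j, A k j * x j - x i / y i * ∑ j, A k j * y j := by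
        rw [Finset.mul_sum, ← Finset.sum_sub_distrib]
        exact Finset.sum_congr rfl fun j _ => by ring
      rw [hsplit, hx2 k hxk, hy2 k ((hsupp k).1 hxk)]
      ring)
  have hxc : ∀ k, x k = x i / y i * y k := fun k => sub_eq_zero.1 (congrFun hz k)
  have hc : x i / y i = 1 := by
    have hsum : ∑ k, x k = x i / y i * ∑ k, y k := by
      rw [Finset.mul_sum]
      exact Finset.sum_congr rfl fun k _ => hxc k
    rw [hx1, hy1] at hsum
    linarith
  funext k
  rw [hxc k, hc, one_mul]

theorem sum_univ_eq_triple {f : n → ℝ} {i j k : n} (hij : i ≠ j) (hik : i ≠ k) (hjk : j ≠ k)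
    (hf : ∀ l, l ≠ i → l ≠ j → l ≠ k → f l = 0) : ∑ l, f l = f i + f j + f k := by
  rw [← Finset.sum_subset (Finset.subset_univ {i, j, k}), Finset.sum_insert, Finset.sum_pair hjk,
    add_assoc]
  · simp [hij, hik]
  · intro l _ hl
    simp only [Finset.mem_insert, Finset.mem_singleton, not_or] at hl
    exact hf l hl.1 hl.2.1 hl.2.2

theorem exists_mem_fixSet_of_cyclic {B : Matrix n n ℝ} (hB : Bᵀ = -B) {i j k : n}
    (hij : i ≠ j) (hik : i ≠ k) (hjk : j ≠ k) (h1 : 0 < B i j) (h2 : 0 < B j k) (h3 : 0 < B k i) :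
    ∃ y ∈ FixSet B, suppFinset y = {i, j, k} := by
  have hskew : ∀ a b, B b a = -B a b := fun a b => congrFun (congrFun hB a) b
  have hdiag : ∀ a, B a a = 0 := fun a => by linarith [hskew a a]
  set S := B i j + B j k + B k i with hS
  have hSpos : 0 < S := by positivity
  set y : n → ℝ := fun l => if l = i then B j k / S else if l = j then B k i / S else
    if l = k then B i j / S else 0 with hy
  have yi : y i = B j k / S := by simp [hy]
  have yj : y j = B k i / S := by simp [hy, hij.symm]
  have yk : y k = B i j / S := by simp [hy, hik.symm, hjk.symm]
  have y0 : ∀ l, l ≠ i → l ≠ j → l ≠ k → y l = 0 := fun l a b c => by simp [hy, a, b, c]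
  have hsum : ∀ l, ∑ m, B l m * y m = B l i * y i + B l j * y j + B l k * y k := fun l =>
    sum_univ_eq_triple (f := fun m => B l m * y m) hij hik hjk fun m a b c => by
      simp [y0 m a b c]
  refine ⟨y, mem_fixSet_iff.2 ⟨fun l => ?_, ?_, fun l hl => ?_⟩, ?_⟩
  · simp only [hy]
    split_ifs <;> positivity
  · rw [sum_univ_eq_triple hij hik hjk y0, yi, yj, yk]
    field_simp
    rw [hS]
    ring
  · rw [hsum, yi, yj, yk]
    by_cases hli : l = i
    · rw [hli, hdiag, hskew k i]
      ring
    by_cases hlj : l = j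
    · rw [hlj, hdiag, hskew i j]
      ring
    by_cases hlk : l = k
    · rw [hlk, hdiag, hskew j k]
      ring
    exact absurd (y0 l hli hlj hlk) hl
  · ext l
    simp only [mem_suppFinset, Finset.mem_insert, Finset.mem_singleton]
    constructor
    · intro hl
      by_contra! h
      exact hl (y0 l h.1 h.2.1 h.2.2)
    · rintro (rfl | rfl | rfl)
      · rw [yi]
        positivity
      · rw [yj]
        positivity
      · rw [yk]
        positivity

theorem cyclic_of_mem_fixSet {A : Matrix n n ℝ} (hA : Aᵀ = -A) {x : n → ℝ} (hx : x ∈ FixSet A)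
    {i j k : n} (hij : i ≠ j) (hik : i ≠ k) (hjk : j ≠ k) (hs : suppFinset x = {i, j, k})
    (h : 0 < A i j) : 0 < A j k ∧ 0 < A k i := by
  have hskew : ∀ a b, A b a = -A a b := fun a b => congrFun (congrFun hA a) b
  have hdiag : ∀ a, A a a = 0 := fun a => by linarith [hskew a a]
  obtain ⟨h0, -, h2⟩ := mem_fixSet_iff.1 hx
  have hmem : ∀ l, x l ≠ 0 ↔ l = i ∨ l = j ∨ l = k := fun l => by
    rw [← mem_suppFinset, hs]
    simp
  have hpos : ∀ l, l = i ∨ l = j ∨ l = k → 0 < x l := fun l hl =>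
    lt_of_le_of_ne (h0 l) ((hmem l).2 hl).symm
  have hsum : ∀ l, ∑ m, A l m * x m = A l i * x i + A l j * x j + A l k * x k := fun l =>
    sum_univ_eq_triple (f := fun m => A l m * x m) hij hik hjk fun m a b c => by
      have : x m = 0 := by
        by_contra hm
        rcases (hmem m).1 hm with h | h | h <;> contradiction
      simp [this]
  have xi := hpos i (by simp)
  have xj := hpos j (by simp)
  have xk := hpos k (by simp)
  have ei := h2 i xi.ne'
  have ej := h2 j xj.ne'
  rw [hsum, hdiag, hskew k i] at ei
  rw [hsum, hdiag, hskew i j] at ej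
  have p1 := mul_pos h xj
  have p2 := mul_pos h xi
  exact ⟨pos_of_mul_pos_left (by linarith : 0 < A j k * x k) xk.le,
    pos_of_mul_pos_left (by linarith : 0 < A k i * x k) xk.le⟩

end FixedPoints

theorem IsTransversal.apply_ne_zero {n : Type*} [Fintype n] [DecidableEq n] {A : Matrix n n ℝ}
    (hA : IsTransversal A) (hskew : Aᵀ = -A) {i j : n} (hij : i ≠ j) : A i j ≠ 0 := by
  intro h
  have hskew' : ∀ a b, A b a = -A a b := fun a b => congrFun (congrFun hskew a) b
  have hz := hA.eq_zero_of_kernel (s := {i, j}) (by simp [Finset.card_pair hij])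
    (z := Pi.single i 1)
    (fun k hk => by
      have : k ≠ i := fun e => hk (by simp [e])
      simp [this])
    (fun k hk => by
      rcases Finset.mem_insert.1 hk with rfl | hk
      · have : A k k = 0 := by linarith [hskew' k k]
        simp [Pi.single_apply, this]
      · rw [Finset.mem_singleton.1 hk]
        simp [Pi.single_apply, hskew' i j, h])
  simpa using congrFun hz i

theorem image_suppFinset_subset {A B : Matrix (Fin 4) (Fin 4) ℝ} (hA : IsTransversal A)
    (hAs : Aᵀ = -A) (hBs : Bᵀ = -B) (hAB : ∀ i j, 0 < A i j → 0 < B i j) :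
    suppFinset '' FixSet A ⊆ suppFinset '' FixSet B := by
  rintro _ ⟨x, hx, rfl⟩
  obtain ⟨m, hm⟩ := odd_card_suppFinset hA hx
  have hle : (suppFinset x).card ≤ 4 := (Finset.card_le_univ _).trans (by simp)
  obtain hc | hc : (suppFinset x).card = 1 ∨ (suppFinset x).card = 3 := by omega
  · obtain ⟨i, hi⟩ := Finset.card_eq_one.1 hc
    obtain ⟨h0, h1, h2⟩ := mem_fixSet_iff.1 hx
    refine ⟨x, mem_fixSet_iff.2 ⟨h0, h1, fun k hk => ?_⟩, rfl⟩
    have hi' : ∀ l, x l ≠ 0 ↔ l = i := fun l => by rw [← mem_suppFinset, hi, Finset.mem_singleton]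
    have hdiag : B i i = 0 := by linarith [show B i i = -B i i from congrFun (congrFun hBs i) i]
    rw [(hi' k).1 hk]
    refine Finset.sum_eq_zero fun l _ => ?_
    by_cases hl : x l = 0
    · rw [hl, mul_zero]
    · rw [(hi' l).1 hl, hdiag, zero_mul]
  · obtain ⟨i, j, k, hij, hik, hjk, hs⟩ := Finset.card_eq_three.1 hc
    have cyc : ∀ i j : Fin 4, i ≠ j → i ≠ k → j ≠ k → suppFinset x = {i, j, k} → 0 < A i j →
        suppFinset x ∈ suppFinset '' FixSet B := by
      intro i j hij hik hjk hs h
      obtain ⟨h1, h2⟩ := cyclic_of_mem_fixSet hAs hx hij hik hjk hs h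
      obtain ⟨y, hy, hys⟩ := exists_mem_fixSet_of_cyclic hBs hij hik hjk (hAB _ _ h)
        (hAB _ _ h1) (hAB _ _ h2)
      exact ⟨y, hy, hys.trans hs.symm⟩
    rcases lt_or_gt_of_ne (hA.apply_ne_zero hAs hij) with h | h
    · have hji : A j i = -A i j := congrFun (congrFun hAs i) j
      exact cyc j i hij.symm hjk hik (by rw [hs, Finset.insert_comm]) (by linarith)
    · exact cyc i j hij hik hjk hs h

/-- The number of fixed points depends only on the signs of the entries. -/
theorem ncard_fixSet_eq_of_sign {A B : Matrix (Fin 4) (Fin 4) ℝ} (hA : IsTransversal A)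
    (hB : IsTransversal B) (hAs : Aᵀ = -A) (hBs : Bᵀ = -B) (hAB : ∀ i j, 0 < A i j ↔ 0 < B i j) :
    (FixSet A).ncard = (FixSet B).ncard := by
  rw [← (injOn_suppFinset hA).ncard_image,
    ← (injOn_suppFinset hB).ncard_image]
  exact congrArg Set.ncard (Set.Subset.antisymm
    (image_suppFinset_subset hA hAs hBs fun i j => (hAB i j).1)
    (image_suppFinset_subset hB hBs hAs fun i j => (hAB i j).2))

/-- The Pfaffian of a skew-symmetric matrix of order four. -/
def pfaffianFour (A : Matrix (Fin 4) (Fin 4) ℝ) : ℝ :=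
  A 0 1 * A 2 3 + A 2 0 * A 1 3 + A 0 3 * A 1 2

theorem det_eq_pfaffianFour_sq {A : Matrix (Fin 4) (Fin 4) ℝ} (hA : Aᵀ = -A) :
    A.det = pfaffianFour A ^ 2 := by
  have hskew : ∀ i j, A j i = -A i j := fun i j => congrFun (congrFun hA i) j
  have hdiag : ∀ i, A i i = 0 := fun i => by linarith [hskew i i]
  rw [Matrix.det_succ_row_zero]
  simp [Fin.sum_univ_succ, Matrix.det_fin_three, Fin.succAbove, pfaffianFour, hdiag]
  rw [hskew 0 1, hskew 0 2, hskew 0 3, hskew 1 2, hskew 1 3, hskew 2 3]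
  ring

theorem det_submatrix_univ {A : Matrix (Fin 4) (Fin 4) ℝ} :
    (A.submatrix (fun i : (Finset.univ : Finset (Fin 4)) => (i : Fin 4))
      (fun i : (Finset.univ : Finset (Fin 4)) => (i : Fin 4))).det = A.det :=
  Matrix.det_submatrix_equiv_self (Equiv.subtypeUnivEquiv Finset.mem_univ) A

theorem det_submatrix_pair {n : Type*} [DecidableEq n] (A : Matrix n n ℝ) {i j : n}
    (hij : i ≠ j) :
    (A.submatrix (fun a : ({i, j} : Finset n) => (a : n))
      (fun a : ({i, j} : Finset n) => (a : n))).det = A i i * A j j - A i j * A j i := by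
  let f : Fin 2 → ({i, j} : Finset n) := ![⟨i, by simp⟩, ⟨j, by simp⟩]
  have hf : Function.Bijective f := by
    constructor
    · intro a b hab
      fin_cases a <;> fin_cases b <;> simp_all [f, eq_comm]
    · rintro ⟨a, ha⟩
      rcases Finset.mem_insert.1 ha with rfl | ha
      · exact ⟨0, rfl⟩
      · exact ⟨1, Subtype.ext (Finset.mem_singleton.1 ha).symm⟩
  rw [← Matrix.det_submatrix_equiv_self (Equiv.ofBijective f hf), Matrix.det_fin_two]
  rfl

theorem isTransversal_iff {A : Matrix (Fin 4) (Fin 4) ℝ} (hA : Aᵀ = -A) :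
    IsTransversal A ↔ (∀ i j, i ≠ j → A i j ≠ 0) ∧ pfaffianFour A ≠ 0 := by
  have hskew : ∀ i j, A j i = -A i j := fun i j => congrFun (congrFun hA i) j
  have hdiag : ∀ i, A i i = 0 := fun i => by linarith [hskew i i]
  refine ⟨fun h => ⟨fun i j hij => h.apply_ne_zero hA hij, fun h0 => ?_⟩, fun h s hs => ?_⟩
  · refine h Finset.univ (by simp; decide) ?_
    rw [det_submatrix_univ, det_eq_pfaffianFour_sq hA, h0]
    ring
  · have hle : s.card ≤ 4 := (Finset.card_le_univ _).trans (by simp)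
    obtain ⟨m, hm⟩ := hs
    obtain hc | hc | hc : s.card = 0 ∨ s.card = 2 ∨ s.card = 4 := by omega
    · obtain rfl := Finset.card_eq_zero.1 hc
      rw [Matrix.det_isEmpty]
      exact one_ne_zero
    · obtain ⟨i, j, hij, rfl⟩ := Finset.card_eq_two.1 hc
      rw [det_submatrix_pair A hij, hdiag, hskew i j]
      have := mul_self_ne_zero.2 (h.1 i j hij)
      intro h0
      apply this
      linarith
    · obtain rfl : s = Finset.univ := (Finset.card_eq_iff_eq_univ s).1 (by simpa using hc)
      rw [det_submatrix_univ, det_eq_pfaffianFour_sq hA]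
      exact pow_ne_zero 2 h.2

/-- The sign encoded by a Boolean. -/
def boolSign (b : Bool) : ℝ := if b then 1 else -1

theorem boolSign_mul_self (b : Bool) : boolSign b * boolSign b = 1 := by
  cases b <;> simp [boolSign]

theorem boolSign_ne_zero (b : Bool) : boolSign b ≠ 0 := by
  cases b <;> simp [boolSign]

theorem boolSign_beq (a b : Bool) : boolSign (a == b) = boolSign a * boolSign b := by
  cases a <;> cases b <;> simp [boolSign]

theorem eq_of_boolSign_mul_pos {a b : Bool} (h : 0 < boolSign a * boolSign b) : a = b := by
  revert h
  cases a <;> cases b <;> norm_num [boolSign]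

theorem boolSign_decide_mul {x : ℝ} (hx : x ≠ 0) : 0 < boolSign (decide (0 < x)) * x := by
  rcases lt_or_gt_of_ne hx with h | h
  · simp [boolSign, h.not_gt, h]
  · simp [boolSign, h]

/-- The skew-symmetric matrix whose Pfaffian is `∑ i, v i 0 * v i 1`. -/
def skewFour (v : Fin 3 → Fin 2 → ℝ) : Matrix (Fin 4) (Fin 4) ℝ :=
  !![0, v 0 0, -v 1 0, v 2 0;
    -v 0 0, 0, v 2 1, v 1 1;
    v 1 0, -v 2 1, 0, v 0 1;
    -v 2 0, -v 1 1, -v 0 1, 0]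

/-- The entries of a skew-symmetric matrix of order four, paired as in the Pfaffian. -/
def coordFour (A : Matrix (Fin 4) (Fin 4) ℝ) : Fin 3 → Fin 2 → ℝ :=
  ![![A 0 1, A 2 3], ![A 2 0, A 1 3], ![A 0 3, A 1 2]]

theorem coordFour_skewFour (v : Fin 3 → Fin 2 → ℝ) : coordFour (skewFour v) = v := by
  funext i j
  fin_cases i <;> fin_cases j <;> rfl

theorem skewFour_coordFour {A : Matrix (Fin 4) (Fin 4) ℝ} (hA : Aᵀ = -A) :
    skewFour (coordFour A) = A := by
  have hskew : ∀ i j, A j i = -A i j := fun i j => congrFun (congrFun hA i) j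
  have hdiag : ∀ i, A i i = 0 := fun i => by linarith [hskew i i]
  ext i j
  fin_cases i <;> fin_cases j <;> simp [skewFour, coordFour, hdiag]
  · exact (hskew 2 0).symm
  · exact (hskew 0 1).symm
  · exact (hskew 1 2).symm
  · exact (hskew 0 3).symm
  · exact (hskew 1 3).symm
  · exact (hskew 2 3).symm

theorem pfaffianFour_eq_sum (A : Matrix (Fin 4) (Fin 4) ℝ) :
    pfaffianFour A = ∑ i, coordFour A i 0 * coordFour A i 1 := by
  simp [Fin.sum_univ_three, pfaffianFour, coordFour]

theorem transpose_skewFour (v : Fin 3 → Fin 2 → ℝ) : (skewFour v)ᵀ = -skewFour v := by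
  ext i j
  fin_cases i <;> fin_cases j <;> simp [skewFour]

theorem skewFour_ne_zero {v : Fin 3 → Fin 2 → ℝ} (hv : ∀ i j, v i j ≠ 0) {i j : Fin 4}
    (hij : i ≠ j) : skewFour v i j ≠ 0 := by
  revert hij
  fin_cases i <;> fin_cases j <;> simp [skewFour, hv]

theorem abs_skewFour_le {v : Fin 3 → Fin 2 → ℝ} (hv : ∀ i j, |v i j| ≤ 1) (i j : Fin 4) :
    |skewFour v i j| ≤ 1 := by
  fin_cases i <;> fin_cases j <;> simp [skewFour, hv]

theorem skewFour_pos_iff {v w : Fin 3 → Fin 2 → ℝ} (h : ∀ i j, 0 < v i j * w i j) (i j : Fin 4) :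
    0 < skewFour v i j ↔ 0 < skewFour w i j := by
  have hpos : ∀ i j, 0 < v i j ↔ 0 < w i j := fun i j => pos_iff_pos_of_mul_pos (h i j)
  have hneg : ∀ i j, v i j < 0 ↔ w i j < 0 := fun i j => neg_iff_neg_of_mul_pos (h i j)
  fin_cases i <;> fin_cases j <;> simp [skewFour, hpos, hneg]

theorem continuous_skewFour : Continuous skewFour := by
  refine continuous_pi fun i => continuous_pi fun j => ?_
  fin_cases i <;> fin_cases j <;> simp [skewFour] <;> fun_prop

theorem continuous_coordFour_apply (i : Fin 3) (j : Fin 2) :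
    Continuous fun A : Matrix (Fin 4) (Fin 4) ℝ => coordFour A i j := by
  fin_cases i <;> fin_cases j <;> exact continuous_id.matrix_elem _ _

theorem coordFour_ne_zero {A : Matrix (Fin 4) (Fin 4) ℝ} (h : ∀ i j, i ≠ j → A i j ≠ 0)
    (i : Fin 3) (j : Fin 2) : coordFour A i j ≠ 0 := by
  fin_cases i <;> fin_cases j <;> exact h _ _ (by decide)

theorem abs_coordFour_le {A : Matrix (Fin 4) (Fin 4) ℝ} (h : ∀ i j, |A i j| ≤ 1)
    (i : Fin 3) (j : Fin 2) : |coordFour A i j| ≤ 1 := by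
  fin_cases i <;> fin_cases j <;> exact h _ _

/-- Magnitudes of the entries for which the Pfaffian, with terms of signs `ε`, is positive. -/
def magnitudeRegion (ε : Fin 3 → Bool) : Set (Fin 3 → Fin 2 → ℝ) :=
  {w | (∀ i j, 0 < w i j ∧ w i j ≤ 1) ∧ 0 < ∑ i, boolSign (ε i) * (w i 0 * w i 1)}

theorem mem_magnitudeRegion_of_le {ε : Fin 3 → Bool} {w w' : Fin 3 → Fin 2 → ℝ}
    (hw : w ∈ magnitudeRegion ε) (hw' : ∀ i j, 0 < w' i j ∧ w' i j ≤ 1)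
    (hinc : ∀ i j, ε i = true → w i j ≤ w' i j) (hdec : ∀ i j, ε i = false → w' i j ≤ w i j) :
    w' ∈ magnitudeRegion ε := by
  refine ⟨hw', hw.2.trans_le (Finset.sum_le_sum fun i _ => ?_)⟩
  cases hε : ε i
  · have := mul_le_mul (hdec i 0 hε) (hdec i 1 hε) (hw' i 1).1.le (hw.1 i 0).1.le
    simpa [boolSign] using this
  · have := mul_le_mul (hinc i 0 hε) (hinc i 1 hε) (hw.1 i 1).1.le (hw' i 0).1.le
    simpa [boolSign] using this

theorem mem_magnitudeRegion_of_le_half {ε : Fin 3 → Bool} (hε : ∃ i, ε i = true)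
    {w : Fin 3 → Fin 2 → ℝ} (hw : ∀ i j, 0 < w i j) (hone : ∀ i j, ε i = true → w i j = 1)
    (hhalf : ∀ i j, ε i = false → w i j ≤ 1 / 2) : w ∈ magnitudeRegion ε := by
  refine ⟨fun i j => ⟨hw i j, ?_⟩, ?_⟩
  · cases h : ε i
    · linarith [hhalf i j h]
    · exact (hone i j h).le
  · have hle : ∀ i, (if ε i then 1 else -(1 / 4) : ℝ) ≤ boolSign (ε i) * (w i 0 * w i 1) := by
      intro i
      cases h : ε i
      · have := mul_le_mul (hhalf i 0 h) (hhalf i 1 h) (hw i 1).le (by norm_num)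
        simp only [boolSign]
        norm_num
        linarith
      · simp [boolSign, hone i _ h]
    refine lt_of_lt_of_le ?_ (Finset.sum_le_sum fun i _ => hle i)
    rw [Fin.sum_univ_three]
    obtain ⟨i, hi⟩ := hε
    fin_cases i <;> simp only [Fin.zero_eta, Fin.mk_one, Fin.reduceFinMk] at hi <;> rw [hi] <;>
      split_ifs <;> norm_num at *

/-- A distinguished point of `magnitudeRegion`. -/
noncomputable def magnitudeCenter (ε : Fin 3 → Bool) : Fin 3 → Fin 2 → ℝ :=
  fun i _ => if ε i then 1 else 1 / 2

theorem magnitudeCenter_mem {ε : Fin 3 → Bool} (hε : ∃ i, ε i = true) :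
    magnitudeCenter ε ∈ magnitudeRegion ε := by
  refine mem_magnitudeRegion_of_le_half hε (fun i j => ?_) (fun i j h => ?_) fun i j h => ?_
  · simp only [magnitudeCenter]
    split_ifs <;> norm_num
  · simp [magnitudeCenter, h]
  · simp [magnitudeCenter, h]

theorem exists_eq_true_of_mem_magnitudeRegion {ε : Fin 3 → Bool} {w : Fin 3 → Fin 2 → ℝ}
    (hw : w ∈ magnitudeRegion ε) : ∃ i, ε i = true := by
  by_contra! h
  refine hw.2.not_ge (Finset.sum_nonpos fun i _ => ?_)
  have := mul_pos (hw.1 i 0).1 (hw.1 i 1).1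
  simp only [boolSign, h i, Bool.false_eq_true, if_false]
  linarith

theorem joinedIn_magnitudeCenter {ε : Fin 3 → Bool} {w : Fin 3 → Fin 2 → ℝ}
    (hw : w ∈ magnitudeRegion ε) : JoinedIn (magnitudeRegion ε) w (magnitudeCenter ε) := by
  have hε := exists_eq_true_of_mem_magnitudeRegion hw
  let u : Fin 3 → Fin 2 → ℝ := fun i j => if ε i then 1 else w i j / 2
  refine JoinedIn.trans (y := u) (JoinedIn.of_segment_subset ?_) (JoinedIn.of_segment_subset ?_)
  · rw [segment_eq_image]
    rintro _ ⟨t, ⟨ht0, ht1⟩, rfl⟩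
    refine mem_magnitudeRegion_of_le hw (fun i j => ?_) (fun i j h => ?_) fun i j h => ?_
    · obtain ⟨h0, h1⟩ := hw.1 i j
      cases h : ε i <;> simp only [Pi.add_apply, Pi.smul_apply, smul_eq_mul, u, h, if_true,
        Bool.false_eq_true, if_false] <;> constructor <;> nlinarith
    · obtain ⟨h0, h1⟩ := hw.1 i j
      simp only [Pi.add_apply, Pi.smul_apply, smul_eq_mul, u, h, if_true]
      nlinarith
    · obtain ⟨h0, h1⟩ := hw.1 i j
      simp only [Pi.add_apply, Pi.smul_apply, smul_eq_mul, u, h, Bool.false_eq_true, if_false]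
      nlinarith
  · rw [segment_eq_image]
    rintro _ ⟨t, ⟨ht0, ht1⟩, rfl⟩
    refine mem_magnitudeRegion_of_le_half hε (fun i j => ?_) (fun i j h => ?_) fun i j h => ?_
    · obtain ⟨h0, h1⟩ := hw.1 i j
      cases h : ε i <;> simp only [Pi.add_apply, Pi.smul_apply, smul_eq_mul, u, magnitudeCenter, h,
        if_true, Bool.false_eq_true, if_false] <;> nlinarith
    · simp [u, magnitudeCenter, h]
    · obtain ⟨h0, h1⟩ := hw.1 i j
      simp only [Pi.add_apply, Pi.smul_apply, smul_eq_mul, u, magnitudeCenter, h,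
        Bool.false_eq_true, if_false]
      nlinarith

/-- The signs of the entries together with the sign of the Pfaffian. -/
abbrev SignPattern := (Fin 3 → Fin 2 → Bool) × Bool

/-- The signs of the Pfaffian terms relative to the sign of the Pfaffian. -/
def SignPattern.relSign (c : SignPattern) (i : Fin 3) : Bool := (c.1 i 0 == c.1 i 1) == c.2

/-- The matrix with signs `c` and magnitudes `w`. -/
def signedMatrix (c : SignPattern) (w : Fin 3 → Fin 2 → ℝ) : Matrix (Fin 4) (Fin 4) ℝ :=
  skewFour fun i j => boolSign (c.1 i j) * w i j

theorem boolSign_mul_pfaffianFour_signedMatrix (c : SignPattern) (w : Fin 3 → Fin 2 → ℝ) :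
    boolSign c.2 * pfaffianFour (signedMatrix c w)
      = ∑ i, boolSign (c.relSign i) * (w i 0 * w i 1) := by
  rw [pfaffianFour_eq_sum, signedMatrix, coordFour_skewFour, Finset.mul_sum]
  refine Finset.sum_congr rfl fun i _ => ?_
  rw [SignPattern.relSign, boolSign_beq, boolSign_beq]
  ring

theorem isQSOMatrix_signedMatrix {c : SignPattern} {w : Fin 3 → Fin 2 → ℝ}
    (hw : w ∈ magnitudeRegion c.relSign) : IsQSOMatrix (signedMatrix c w) := by
  refine ⟨transpose_skewFour _, abs_skewFour_le fun i j => ?_⟩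
  have habs : |boolSign (c.1 i j)| = 1 := by cases c.1 i j <;> simp [boolSign]
  rw [abs_mul, habs, one_mul, abs_of_pos (hw.1 i j).1]
  exact (hw.1 i j).2

theorem isTransversal_signedMatrix {c : SignPattern} {w : Fin 3 → Fin 2 → ℝ}
    (hw : w ∈ magnitudeRegion c.relSign) : IsTransversal (signedMatrix c w) := by
  refine (isTransversal_iff (transpose_skewFour _)).2 ⟨fun i j hij => skewFour_ne_zero
    (fun i j => mul_ne_zero (boolSign_ne_zero _) (hw.1 i j).1.ne') hij, fun h => ?_⟩
  have hpos := hw.2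
  rw [← boolSign_mul_pfaffianFour_signedMatrix, signedMatrix, h, mul_zero] at hpos
  exact hpos.false

theorem ncard_fixSet_signedMatrix {c : SignPattern} {w w' : Fin 3 → Fin 2 → ℝ}
    (hw : w ∈ magnitudeRegion c.relSign) (hw' : w' ∈ magnitudeRegion c.relSign) :
    (FixSet (signedMatrix c w)).ncard = (FixSet (signedMatrix c w')).ncard := by
  refine ncard_fixSet_eq_of_sign (isTransversal_signedMatrix hw) (isTransversal_signedMatrix hw')
    (transpose_skewFour _) (transpose_skewFour _) (skewFour_pos_iff fun i j => ?_)
  rw [mul_mul_mul_comm, boolSign_mul_self, one_mul]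
  exact mul_pos (hw.1 i j).1 (hw'.1 i j).1

theorem qsoHomotopic_signedMatrix {c : SignPattern} {w w' : Fin 3 → Fin 2 → ℝ}
    (h : JoinedIn (magnitudeRegion c.relSign) w w') :
    QSOHomotopic (signedMatrix c w) (signedMatrix c w') := by
  obtain ⟨γ, hγ⟩ := h
  have hmem : ∀ t ∈ Set.Icc (0 : ℝ) 1, γ.extend t ∈ magnitudeRegion c.relSign := fun t ht => by
    rw [γ.extend_apply ht]
    exact hγ _
  have hw : w ∈ magnitudeRegion c.relSign := by simpa using hγ 0
  have hw' : w' ∈ magnitudeRegion c.relSign := by simpa using hγ 1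
  refine ⟨fun t => signedMatrix c (γ.extend t), ?_, by simp, by simp,
    fun t ht => ⟨isQSOMatrix_signedMatrix (hmem t ht), isTransversal_signedMatrix (hmem t ht)⟩,
    fun t ht => ncard_fixSet_signedMatrix (hmem t ht) hw, ncard_fixSet_signedMatrix hw hw'⟩
  refine (continuous_skewFour.comp (continuous_pi fun i => continuous_pi fun j => ?_)).continuousOn
  exact continuous_const.mul
    ((continuous_apply j).comp ((continuous_apply i).comp γ.continuous_extend))

theorem exists_eq_signedMatrix {A : Matrix (Fin 4) (Fin 4) ℝ} (hA : IsQSOMatrix A)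
    (hT : IsTransversal A) :
    ∃ c : SignPattern, ∃ w ∈ magnitudeRegion c.relSign, A = signedMatrix c w := by
  obtain ⟨hne, hpf⟩ := (isTransversal_iff hA.1).1 hT
  let c : SignPattern :=
    (fun i j => decide (0 < coordFour A i j), decide (0 < pfaffianFour A))
  let w : Fin 3 → Fin 2 → ℝ := fun i j => boolSign (c.1 i j) * coordFour A i j
  have hAw : A = signedMatrix c w := by
    simp only [signedMatrix, w, ← mul_assoc, boolSign_mul_self, one_mul]
    exact (skewFour_coordFour hA.1).symm
  refine ⟨c, w, ⟨fun i j => ⟨boolSign_decide_mul (coordFour_ne_zero hne i j), ?_⟩, ?_⟩, hAw⟩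
  · have habs : |boolSign (c.1 i j)| = 1 := by cases c.1 i j <;> simp [boolSign]
    refine (le_abs_self _).trans ?_
    rw [abs_mul, habs, one_mul]
    exact abs_coordFour_le hA.2 i j
  · rw [← boolSign_mul_pfaffianFour_signedMatrix, ← hAw]
    exact boolSign_decide_mul hpf

theorem mul_pos_of_continuousOn_of_ne_zero {f : ℝ → ℝ} (hf : ContinuousOn f (Set.Icc 0 1))
    (h : ∀ t ∈ Set.Icc (0 : ℝ) 1, f t ≠ 0) : 0 < f 0 * f 1 := by
  by_contra! hle
  have hzero : (0 : ℝ) ∈ Set.uIcc (f 0) (f 1) := by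
    rw [Set.mem_uIcc]
    rcases mul_nonpos_iff.1 hle with h | h
    · exact Or.inr ⟨h.2, h.1⟩
    · exact Or.inl h
  obtain ⟨t, ht, ht0⟩ := intermediate_value_uIcc (by simpa using hf) hzero
  exact h t (by simpa using ht) ht0

theorem signPattern_eq_of_qsoHomotopic {c c' : SignPattern} {w w' : Fin 3 → Fin 2 → ℝ}
    (hw : w ∈ magnitudeRegion c.relSign) (hw' : w' ∈ magnitudeRegion c'.relSign)
    (h : QSOHomotopic (signedMatrix c w) (signedMatrix c' w')) : c = c' := by
  obtain ⟨A, hcont, h0, h1, hA, -⟩ := h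
  have hne := fun t ht => (isTransversal_iff (hA t ht).1.1).1 (hA t ht).2
  have hcoord : ∀ i j, ContinuousOn (fun t => coordFour (A t) i j) (Set.Icc 0 1) := fun i j =>
    (continuous_coordFour_apply i j).comp_continuousOn hcont
  refine Prod.ext (funext fun i => funext fun j => eq_of_boolSign_mul_pos ?_)
    (eq_of_boolSign_mul_pos ?_)
  · have hpos := mul_pos_of_continuousOn_of_ne_zero (hcoord i j)
      fun t ht => coordFour_ne_zero (hne t ht).1 i j
    simp only [h0, h1, signedMatrix, coordFour_skewFour] at hpos
    rw [mul_mul_mul_comm] at hpos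
    exact pos_of_mul_pos_left hpos (mul_pos (hw.1 i j).1 (hw'.1 i j).1).le
  · have hpf : ContinuousOn (fun t => pfaffianFour (A t)) (Set.Icc 0 1) := by
      simp only [pfaffianFour_eq_sum]
      exact continuousOn_finsetSum _ fun i _ => (hcoord i 0).mul (hcoord i 1)
    have hpos := mul_pos_of_continuousOn_of_ne_zero hpf fun t ht => (hne t ht).2
    rw [h0, h1] at hpos
    have hw2 := hw.2
    have hw2' := hw'.2
    rw [← boolSign_mul_pfaffianFour_signedMatrix] at hw2 hw2'
    have := mul_pos hw2 hw2'
    rw [mul_mul_mul_comm] at this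
    exact pos_of_mul_pos_left this hpos.le

theorem card_realizable_signPattern :
    Fintype.card {c : SignPattern // ∃ i, c.relSign i = true} = 112 := by
  decide +kernel

theorem one_hundred_twelve_homotopy_classes_dim_four :
    ∃ B : Fin 112 → Matrix (Fin 4) (Fin 4) ℝ,
      (∀ i, IsQSOMatrix (B i) ∧ IsTransversal (B i)) ∧
      (∀ i j, i ≠ j → ¬ QSOHomotopic (B i) (B j)) ∧
      (∀ A : Matrix (Fin 4) (Fin 4) ℝ, IsQSOMatrix A → IsTransversal A →
        ∃ i, QSOHomotopic A (B i)) := by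
  let e : Fin 112 ≃ {c : SignPattern // ∃ i, c.relSign i = true} :=
    (Fintype.equivFinOfCardEq card_realizable_signPattern).symm
  have hmem : ∀ i, magnitudeCenter (e i).1.relSign ∈ magnitudeRegion (e i).1.relSign := fun i =>
    magnitudeCenter_mem (e i).2
  refine ⟨fun i => signedMatrix (e i).1 (magnitudeCenter (e i).1.relSign), fun i =>
    ⟨isQSOMatrix_signedMatrix (hmem i), isTransversal_signedMatrix (hmem i)⟩,
    fun i j hij h => hij (e.injective (Subtype.ext
      (signPattern_eq_of_qsoHomotopic (hmem i) (hmem j) h))), fun A hA hT => ?_⟩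
  obtain ⟨c, w, hw, rfl⟩ := exists_eq_signedMatrix hA hT
  refine ⟨e.symm ⟨c, exists_eq_true_of_mem_magnitudeRegion hw⟩, ?_⟩
  simp only [Equiv.apply_symm_apply]
  exact qsoHomotopic_signedMatrix (joinedIn_magnitudeCenter hw)
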